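/- Suppose each g_i is in addition μ-strongly convex with μ > 0, σ > 0 is compatible with the partition (‖Ax‖² ≤ σ Σ_{k=1}^K ‖A x_[k]‖² for all x), c_A > 0 satisfies ‖Ax‖² ≤ c_A ‖x‖² for all x ∈ ℝ^n, and F attains its minimum value F*. Fix α ∈ ℝ^n and θ ∈ (0,1], and let Δ_[k] be a θ-approximate solution of the k-th local subproblem at α, for each k = 1,…,K. Then one CoCoA round contracts the suboptimality: F(α + Σ_{k=1}^K Δ_[k]) − F* ≤ (1 − (1−θ)·μ/(μ + σβ c_A)) · (F(α) − F*). -/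

import Mathlib

open RealInnerProductSpace Finset

noncomputable section

/-- Matrix–vector product `A x` viewed as a map between Euclidean spaces. -/
def mulVecE {d n : ℕ} (A : Matrix (Fin d) (Fin n) ℝ) (x : EuclideanSpace ℝ (Fin n)) :
    EuclideanSpace ℝ (Fin d) :=
  (WithLp.equiv 2 _).symm (A.mulVec ((WithLp.equiv 2 _) x))

/-- `restr I x` (written `x_[k]` in the paper) equals `x` on the coordinates in `I`
and is zero elsewhere. -/
def restr {n : ℕ} (I : Finset (Fin n)) (x : EuclideanSpace ℝ (Fin n)) :
    EuclideanSpace ℝ (Fin n) :=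
  (WithLp.equiv 2 _).symm (fun i => if i ∈ I then x i else 0)

/-- The global objective `F(α) = f(Aα) + ∑ i g i (α i)`. -/
def objF {d n : ℕ} (A : Matrix (Fin d) (Fin n) ℝ) (f : EuclideanSpace ℝ (Fin d) → ℝ)
    (g : Fin n → ℝ → ℝ) (α : EuclideanSpace ℝ (Fin n)) : ℝ :=
  f (mulVecE A α) + ∑ i, g i (α i)

/-- The CoCoA local subproblem objective
`F_σ^{(k)}(Δ; α, v) = (1/K) f(v) + ⟨∇f(v), AΔ⟩ + (σβ/2)‖AΔ‖² + ∑_{i ∈ I_k} g i (α i + Δ i)`,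
where `v = Aα` and `f'` is the gradient of `f`. -/
def locF {d n : ℕ} (A : Matrix (Fin d) (Fin n) ℝ) (f : EuclideanSpace ℝ (Fin d) → ℝ)
    (f' : EuclideanSpace ℝ (Fin d) → EuclideanSpace ℝ (Fin d))
    (g : Fin n → ℝ → ℝ) (K : ℕ) (σ β : ℝ) (Ik : Finset (Fin n))
    (α Δ : EuclideanSpace ℝ (Fin n)) : ℝ :=
  (1 / (K : ℝ)) * f (mulVecE A α) + ⟪f' (mulVecE A α), mulVecE A Δ⟫
    + σ * β / 2 * ‖mulVecE A Δ‖ ^ 2 + ∑ i ∈ Ik, g i (α i + Δ i)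

/-- Infimum of the local subproblem objective over vectors supported on `Ik`. -/
def locInf {d n : ℕ} (A : Matrix (Fin d) (Fin n) ℝ) (f : EuclideanSpace ℝ (Fin d) → ℝ)
    (f' : EuclideanSpace ℝ (Fin d) → EuclideanSpace ℝ (Fin d))
    (g : Fin n → ℝ → ℝ) (K : ℕ) (σ β : ℝ) (Ik : Finset (Fin n))
    (α : EuclideanSpace ℝ (Fin n)) : ℝ :=
  sInf ((locF A f f' g K σ β Ik α) '' {Δ | ∀ i ∉ Ik, Δ i = 0})

/-- `Δk` is a θ-approximate solution of the `k`-th local subproblem at `α`. -/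
def IsApprox {d n : ℕ} (A : Matrix (Fin d) (Fin n) ℝ) (f : EuclideanSpace ℝ (Fin d) → ℝ)
    (f' : EuclideanSpace ℝ (Fin d) → EuclideanSpace ℝ (Fin d))
    (g : Fin n → ℝ → ℝ) (K : ℕ) (σ β θ : ℝ) (Ik : Finset (Fin n))
    (α Δk : EuclideanSpace ℝ (Fin n)) : Prop :=
  (∀ i ∉ Ik, Δk i = 0) ∧
    locF A f f' g K σ β Ik α Δk - locInf A f f' g K σ β Ik α ≤
      θ * (locF A f f' g K σ β Ik α 0 - locInf A f f' g K σ β Ik α)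

lemma mulVecE_eq_toEuclideanLin {d n : ℕ} (A : Matrix (Fin d) (Fin n) ℝ)
    (x : EuclideanSpace ℝ (Fin n)) : mulVecE A x = A.toEuclideanLin x := rfl

@[simp] lemma mulVecE_zero {d n : ℕ} (A : Matrix (Fin d) (Fin n) ℝ) : mulVecE A 0 = 0 := by
  simp [mulVecE_eq_toEuclideanLin]

lemma mulVecE_sub {d n : ℕ} (A : Matrix (Fin d) (Fin n) ℝ) (x y : EuclideanSpace ℝ (Fin n)) :
    mulVecE A (x - y) = mulVecE A x - mulVecE A y := by
  simp [mulVecE_eq_toEuclideanLin]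

lemma mulVecE_smul {d n : ℕ} (A : Matrix (Fin d) (Fin n) ℝ) (c : ℝ)
    (x : EuclideanSpace ℝ (Fin n)) : mulVecE A (c • x) = c • mulVecE A x := by
  simp [mulVecE_eq_toEuclideanLin]

lemma mulVecE_sum {d n : ℕ} {κ : Type*} (A : Matrix (Fin d) (Fin n) ℝ) (s : Finset κ)
    (x : κ → EuclideanSpace ℝ (Fin n)) :
    mulVecE A (∑ k ∈ s, x k) = ∑ k ∈ s, mulVecE A (x k) := by
  simp [mulVecE_eq_toEuclideanLin]

@[simp] lemma restr_apply {n : ℕ} (I : Finset (Fin n)) (x : EuclideanSpace ℝ (Fin n))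
    (i : Fin n) : restr I x i = if i ∈ I then x i else 0 := rfl

lemma norm_restr_sq {n : ℕ} (I : Finset (Fin n)) (x : EuclideanSpace ℝ (Fin n)) :
    ‖restr I x‖ ^ 2 = ∑ i ∈ I, x i ^ 2 := by
  simp [EuclideanSpace.norm_sq_eq, ite_pow, Finset.sum_ite_mem]

/-- First-order characterization of convexity: the tangent plane lies below the graph. -/
lemma ConvexOn.add_inner_gradient_le {E : Type*} [NormedAddCommGroup E]
    [InnerProductSpace ℝ E] [CompleteSpace E] {f : E → ℝ} {f'u u : E}
    (hf : ConvexOn ℝ Set.univ f) (hu : HasGradientAt f f'u u) (w : E) :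
    f u + ⟪f'u, w - u⟫ ≤ f w := by
  have hline : ConvexOn ℝ Set.univ (f ∘ AffineMap.lineMap (k := ℝ) u w) := by
    simpa using hf.comp_affineMap (AffineMap.lineMap u w)
  have hderiv : HasDerivAt (f ∘ AffineMap.lineMap (k := ℝ) u w) ⟪f'u, w - u⟫ 0 := by
    have hu' : HasFDerivAt f (InnerProductSpace.toDual ℝ E f'u)
        (AffineMap.lineMap (k := ℝ) u w 0) := by
      simpa using hu.hasFDerivAt
    simpa using hu'.comp_hasDerivAt (0 : ℝ) AffineMap.hasDerivAt_lineMap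
  have hslope := hline.le_slope_of_hasDerivAt (Set.mem_univ 0) (Set.mem_univ 1) one_pos hderiv
  simp only [slope_def_field, Function.comp_apply, AffineMap.lineMap_apply_one,
    AffineMap.lineMap_apply_zero, sub_zero, div_one] at hslope
  linarith

lemma StrongConvexOn.exists_forall_le {φ : ℝ → ℝ} {μ : ℝ} (hμ : 0 < μ)
    (hφ : StrongConvexOn Set.univ μ φ) : ∃ c, ∀ y, c ≤ φ y := by
  have hconv := strongConvexOn_iff_convex.1 hφ
  set h : ℝ → ℝ := fun x => φ x - μ / 2 * ‖x‖ ^ 2 with hh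
  have haffine : ∃ M, ∀ y, h 0 - M * |y| ≤ h y := by
    refine ⟨max (h 1 - h 0) (h (-1) - h 0), fun y => ?_⟩
    have key : ∀ e z : ℝ, 0 ≤ z → h 0 - (h e - h 0) * z ≤ h (-z * e) := by
      intro e z hz
      have hpos : 0 < 1 + z := by linarith
      have hc := hconv.2 (Set.mem_univ e) (Set.mem_univ (-z * e))
        (show 0 ≤ z / (1 + z) by positivity) (show 0 ≤ 1 / (1 + z) by positivity)
        (by field_simp; ring)
      have h0 : (z / (1 + z)) • e + (1 / (1 + z)) • (-z * e) = 0 := by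
        simp only [smul_eq_mul]; ring
      rw [h0, smul_eq_mul, smul_eq_mul, div_mul_eq_mul_div, div_mul_eq_mul_div, ← add_div,
        le_div_iff₀ hpos] at hc
      linarith
    rcases le_total 0 y with hy | hy
    · have := key (-1) y hy
      have hM := mul_le_mul_of_nonneg_right (le_max_right (h 1 - h 0) (h (-1) - h 0)) hy
      rw [abs_of_nonneg hy]
      simp only [mul_neg, mul_one, neg_neg] at this
      linarith
    · have := key 1 (-y) (by linarith)
      have hM := mul_le_mul_of_nonneg_right (le_max_left (h 1 - h 0) (h (-1) - h 0))
        (neg_nonneg.2 hy)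
      rw [abs_of_nonpos hy]
      simp only [mul_one, neg_neg] at this
      linarith
  obtain ⟨M, hM⟩ := haffine
  refine ⟨h 0 - M ^ 2 / (2 * μ), fun y => ?_⟩
  have hy := hM y
  have hsq : 0 ≤ (μ * |y| - M) ^ 2 / (2 * μ) := by positivity
  have hexp : (μ * |y| - M) ^ 2 / (2 * μ) = μ / 2 * |y| ^ 2 - M * |y| + M ^ 2 / (2 * μ) := by
    field_simp
    ring
  have hφy : φ y = h y + μ / 2 * |y| ^ 2 := by simp [hh]
  linarith

lemma bddBelow_range_locF {d n : ℕ} (A : Matrix (Fin d) (Fin n) ℝ)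
    (f : EuclideanSpace ℝ (Fin d) → ℝ)
    (f' : EuclideanSpace ℝ (Fin d) → EuclideanSpace ℝ (Fin d)) {g : Fin n → ℝ → ℝ}
    (hg : ∀ i, ∃ c, ∀ y, c ≤ g i y) (K : ℕ) {σ β : ℝ} (hσ : 0 < σ) (hβ : 0 < β)
    (I : Finset (Fin n)) (α : EuclideanSpace ℝ (Fin n)) :
    BddBelow (Set.range (locF A f f' g K σ β I α)) := by
  choose c hc using hg
  have hσβ : 0 < σ * β := mul_pos hσ hβ
  refine ⟨1 / (K : ℝ) * f (mulVecE A α) - ‖f' (mulVecE A α)‖ ^ 2 / (2 * (σ * β))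
    + ∑ i ∈ I, c i, ?_⟩
  rintro _ ⟨x, rfl⟩
  have hsum : ∑ i ∈ I, c i ≤ ∑ i ∈ I, g i (α i + x i) := Finset.sum_le_sum fun i _ => hc i _
  have hinner := neg_le_of_abs_le (abs_real_inner_le_norm (f' (mulVecE A α)) (mulVecE A x))
  have hsq : 0 ≤ (σ * β * ‖mulVecE A x‖ - ‖f' (mulVecE A α)‖) ^ 2 / (2 * (σ * β)) := by
    positivity
  have hexp : (σ * β * ‖mulVecE A x‖ - ‖f' (mulVecE A α)‖) ^ 2 / (2 * (σ * β)) =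
      σ * β / 2 * ‖mulVecE A x‖ ^ 2 - ‖f' (mulVecE A α)‖ * ‖mulVecE A x‖
        + ‖f' (mulVecE A α)‖ ^ 2 / (2 * (σ * β)) := by
    field_simp
    ring
  unfold locF
  linarith

/-- A `θ`-approximate solution is at least as good as the `θ`-weighted average of the zero
update and any competitor supported on the block. -/
lemma IsApprox.locF_le {d n K : ℕ} {A : Matrix (Fin d) (Fin n) ℝ}
    {f : EuclideanSpace ℝ (Fin d) → ℝ}
    {f' : EuclideanSpace ℝ (Fin d) → EuclideanSpace ℝ (Fin d)} {g : Fin n → ℝ → ℝ}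
    {σ β θ : ℝ} {I : Finset (Fin n)} {α Δ x : EuclideanSpace ℝ (Fin n)}
    (hΔ : IsApprox A f f' g K σ β θ I α Δ) (hθ : θ ≤ 1)
    (hbdd : BddBelow (Set.range (locF A f f' g K σ β I α))) (hx : ∀ i ∉ I, x i = 0) :
    locF A f f' g K σ β I α Δ ≤
      (1 - θ) * locF A f f' g K σ β I α x + θ * locF A f f' g K σ β I α 0 := by
  have hinf : locInf A f f' g K σ β I α ≤ locF A f f' g K σ β I α x :=
    csInf_le (hbdd.mono (Set.image_subset_range _ _)) (Set.mem_image_of_mem _ hx)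
  have := mul_le_mul_of_nonneg_left hinf (sub_nonneg.2 hθ)
  linarith [hΔ.2]

section Partition

variable {n K : ℕ} {I : Fin K → Finset (Fin n)}

lemma sum_sum_of_partition (hdisj : ∀ k l, k ≠ l → Disjoint (I k) (I l))
    (hcover : ∀ i, ∃ k, i ∈ I k) (c : Fin n → ℝ) : ∑ k, ∑ i ∈ I k, c i = ∑ i, c i := by
  have huniv : (univ : Finset (Fin n)) = univ.biUnion I := by
    ext i
    simpa using hcover i
  rw [huniv, Finset.sum_biUnion fun k _ l _ hkl => hdisj k l hkl]

lemma sum_apply_of_mem (hdisj : ∀ k l, k ≠ l → Disjoint (I k) (I l))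
    {Δ : Fin K → EuclideanSpace ℝ (Fin n)} (hΔ : ∀ k, ∀ i ∉ I k, Δ k i = 0)
    {k : Fin K} {i : Fin n} (hi : i ∈ I k) : (∑ l, Δ l) i = Δ k i := by
  rw [WithLp.ofLp_sum, Finset.sum_apply]
  exact Finset.sum_eq_single k
    (fun l _ hl => hΔ l i (Finset.disjoint_left.1 (hdisj k l hl.symm) hi)) (by simp)

lemma restr_sum (hdisj : ∀ k l, k ≠ l → Disjoint (I k) (I l))
    {Δ : Fin K → EuclideanSpace ℝ (Fin n)} (hΔ : ∀ k, ∀ i ∉ I k, Δ k i = 0) (k : Fin K) :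
    restr (I k) (∑ l, Δ l) = Δ k := by
  ext i
  by_cases hi : i ∈ I k
  · rw [restr_apply, if_pos hi, sum_apply_of_mem hdisj hΔ hi]
  · rw [restr_apply, if_neg hi, hΔ k i hi]

lemma sum_restr (hdisj : ∀ k l, k ≠ l → Disjoint (I k) (I l)) (hcover : ∀ i, ∃ k, i ∈ I k)
    (x : EuclideanSpace ℝ (Fin n)) : ∑ k, restr (I k) x = x := by
  ext i
  obtain ⟨k, hk⟩ := hcover i
  rw [sum_apply_of_mem hdisj (fun l j hj => by simp [hj]) hk, restr_apply, if_pos hk]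

/-- The local objectives add up to a separable quadratic model of the global objective. -/
lemma sum_locF {d : ℕ} (hdisj : ∀ k l, k ≠ l → Disjoint (I k) (I l))
    (hcover : ∀ i, ∃ k, i ∈ I k) (hK : K ≠ 0) (A : Matrix (Fin d) (Fin n) ℝ)
    (f : EuclideanSpace ℝ (Fin d) → ℝ)
    (f' : EuclideanSpace ℝ (Fin d) → EuclideanSpace ℝ (Fin d)) (g : Fin n → ℝ → ℝ) (σ β : ℝ)
    (α : EuclideanSpace ℝ (Fin n)) {Δ : Fin K → EuclideanSpace ℝ (Fin n)}
    (hΔ : ∀ k, ∀ i ∉ I k, Δ k i = 0) :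
    ∑ k, locF A f f' g K σ β (I k) α (Δ k) =
      f (mulVecE A α) + ⟪f' (mulVecE A α), mulVecE A (∑ k, Δ k)⟫
        + σ * β / 2 * ∑ k, ‖mulVecE A (Δ k)‖ ^ 2 + ∑ i, g i ((α + ∑ k, Δ k) i) := by
  have hK' : (K : ℝ) ≠ 0 := Nat.cast_ne_zero.2 hK
  have hg : ∑ k, ∑ i ∈ I k, g i (α i + Δ k i) = ∑ i, g i ((α + ∑ k, Δ k) i) := by
    rw [← sum_sum_of_partition hdisj hcover]
    refine Finset.sum_congr rfl fun k _ => Finset.sum_congr rfl fun i hi => ?_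
    rw [PiLp.add_apply, sum_apply_of_mem hdisj hΔ hi]
  simp only [locF, Finset.sum_add_distrib, hg, mulVecE_sum, inner_sum, ← Finset.mul_sum]
  simp [hK']

end Partition

/-- One CoCoA round with θ-approximate local solvers contracts the
suboptimality by the factor `1 − (1−θ)·μ/(μ + σβc_A)` when the `g i` are μ-strongly
convex. -/
theorem stmt_2 {d n K : ℕ} (A : Matrix (Fin d) (Fin n) ℝ)
    (f : EuclideanSpace ℝ (Fin d) → ℝ)
    (f' : EuclideanSpace ℝ (Fin d) → EuclideanSpace ℝ (Fin d))
    (β : ℝ) (hβ : 0 < β)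
    (hconvf : ConvexOn ℝ Set.univ f)
    (hgrad : ∀ u, HasGradientAt f (f' u) u)
    (hsmooth : ∀ u w : EuclideanSpace ℝ (Fin d),
      f w ≤ f u + ⟪f' u, w - u⟫ + β / 2 * ‖w - u‖ ^ 2)
    (g : Fin n → ℝ → ℝ) (μ : ℝ) (hμ : 0 < μ)
    (hg : ∀ i, StrongConvexOn Set.univ μ (g i))
    (I : Fin K → Finset (Fin n))
    (hne : ∀ k, (I k).Nonempty)
    (hdisj : ∀ k l, k ≠ l → Disjoint (I k) (I l))
    (hcover : ∀ i, ∃ k, i ∈ I k)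
    (σ : ℝ) (hσ : 0 < σ)
    (hcompat : ∀ x : EuclideanSpace ℝ (Fin n),
      ‖mulVecE A x‖ ^ 2 ≤ σ * ∑ k, ‖mulVecE A (restr (I k) x)‖ ^ 2)
    (cA : ℝ) (hcA : 0 < cA)
    (hAbound : ∀ x : EuclideanSpace ℝ (Fin n), ‖mulVecE A x‖ ^ 2 ≤ cA * ‖x‖ ^ 2)
    (αstar : EuclideanSpace ℝ (Fin n))
    (hmin : ∀ x : EuclideanSpace ℝ (Fin n), objF A f g αstar ≤ objF A f g x)
    (α : EuclideanSpace ℝ (Fin n)) (θ : ℝ) (hθ : θ ∈ Set.Ioc (0 : ℝ) 1)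
    (Δ : Fin K → EuclideanSpace ℝ (Fin n))
    (happrox : ∀ k, IsApprox A f f' g K σ β θ (I k) α (Δ k)) :
    objF A f g (α + ∑ k, Δ k) - objF A f g αstar ≤
      (1 - (1 - θ) * (μ / (μ + σ * β * cA))) * (objF A f g α - objF A f g αstar) := by
  rcases Nat.eq_zero_or_pos K with rfl | hK
  · have : IsEmpty (Fin n) := ⟨fun i => (hcover i).choose.elim0⟩
    rw [Subsingleton.elim (α + ∑ k, Δ k) αstar, Subsingleton.elim α αstar]
    simp
  have hD : 0 < μ + σ * β * cA := by positivity
  set s := μ / (μ + σ * β * cA) with hs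
  have hs0 : 0 ≤ s := by positivity
  have hs1 : s ≤ 1 := (div_le_one hD).2 (by linarith [mul_pos (mul_pos hσ hβ) hcA])
  have hsD : s * (σ * β * cA) = (1 - s) * μ := by
    rw [hs]
    field_simp
    ring
  have hsupp : ∀ k, ∀ i ∉ I k, Δ k i = 0 := fun k => (happrox k).1
  set u := αstar - α with hu
  have hsupp' : ∀ k, ∀ i ∉ I k, (s • restr (I k) u) i = 0 := fun k i hi => by simp [hi]
  have hmodel := sum_locF hdisj hcover hK.ne' A f f' g σ β α hsupp
  have hmodel0 := sum_locF hdisj hcover hK.ne' A f f' g σ β α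
    (Δ := fun _ => 0) (fun _ _ _ => rfl)
  have hmodel' := sum_locF hdisj hcover hK.ne' A f f' g σ β α hsupp'
  have hdescent : objF A f g (α + ∑ k, Δ k) ≤
      ∑ k, locF A f f' g K σ β (I k) α (Δ k) := by
    have hf := hsmooth (mulVecE A α) (mulVecE A (α + ∑ k, Δ k))
    rw [← mulVecE_sub, add_sub_cancel_left] at hf
    have hquad := hcompat (∑ k, Δ k)
    simp only [restr_sum hdisj hsupp] at hquad
    have := mul_le_mul_of_nonneg_left hquad (half_pos hβ).le
    rw [hmodel, objF]
    linarith
  have hzero : ∑ k, locF A f f' g K σ β (I k) α 0 = objF A f g α := by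
    rw [hmodel0]
    simp [objF]
  have hcomp : ∑ k, locF A f f' g K σ β (I k) α (s • restr (I k) u) ≤
      (1 - s) * objF A f g α + s * objF A f g αstar := by
    rw [hmodel', ← Finset.smul_sum, sum_restr hdisj hcover, mulVecE_smul, inner_smul_right]
    have hf := hconvf.add_inner_gradient_le (hgrad (mulVecE A α)) (mulVecE A αstar)
    rw [← mulVecE_sub, ← hu] at hf
    have hf_s := mul_le_mul_of_nonneg_left hf hs0
    have hquad : ∑ k, ‖mulVecE A (s • restr (I k) u)‖ ^ 2 ≤ s ^ 2 * (cA * ∑ i, u i ^ 2) := by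
      rw [← sum_sum_of_partition hdisj hcover, Finset.mul_sum, Finset.mul_sum]
      refine Finset.sum_le_sum fun k _ => ?_
      rw [mulVecE_smul, norm_smul, mul_pow, Real.norm_eq_abs, sq_abs, ← norm_restr_sq]
      exact mul_le_mul_of_nonneg_left (hAbound _) (sq_nonneg s)
    have hquad_σβ := mul_le_mul_of_nonneg_left hquad (half_pos (mul_pos hσ hβ)).le
    have hsum : ∑ i, g i ((α + s • u) i) ≤ (1 - s) * ∑ i, g i (α i) + s * ∑ i, g i (αstar i)
        - (1 - s) * s * (μ / 2 * ∑ i, u i ^ 2) := by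
      simp only [Finset.mul_sum, ← Finset.sum_add_distrib, ← Finset.sum_sub_distrib]
      refine Finset.sum_le_sum fun i _ => ?_
      have hgi := (hg i).2 (Set.mem_univ (α i)) (Set.mem_univ (αstar i))
        (sub_nonneg.2 hs1) hs0 (by ring)
      have hpoint : (α + s • u) i = (1 - s) • α i + s • αstar i := by
        simp [hu]
        ring
      have hnorm : ‖α i - αstar i‖ ^ 2 = u i ^ 2 := by
        rw [norm_sub_rev, Real.norm_eq_abs, sq_abs, hu, PiLp.sub_apply]
      rw [hpoint]
      simpa only [smul_eq_mul, hnorm] using hgi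
    have hcancel : σ * β / 2 * (s ^ 2 * (cA * ∑ i, u i ^ 2)) =
        (1 - s) * s * (μ / 2 * ∑ i, u i ^ 2) := by
      linear_combination (s / 2 * ∑ i, u i ^ 2) * hsD
    simp only [objF]
    linarith
  have happrox_sum : ∑ k, locF A f f' g K σ β (I k) α (Δ k) ≤
      (1 - θ) * ∑ k, locF A f f' g K σ β (I k) α (s • restr (I k) u)
        + θ * ∑ k, locF A f f' g K σ β (I k) α 0 := by
    rw [Finset.mul_sum, Finset.mul_sum, ← Finset.sum_add_distrib]
    exact Finset.sum_le_sum fun k _ => (happrox k).locF_le hθ.2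
      (bddBelow_range_locF A f f' (fun i => (hg i).exists_forall_le hμ) K hσ hβ (I k) α)
      (hsupp' k)
  rw [hzero] at happrox_sum
  have := mul_le_mul_of_nonneg_left hcomp (sub_nonneg.2 hθ.2)
  linarith
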